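/- arXiv:2307.11659 — 6 statements merged into one kernel-verified Lean document; each statement's English description precedes it below -/
import Mathlib

section
/- Energy–distance inequality for flows (linear version of Proposition B.2). Let E be a real normed vector space, V : ℝ → E → E a time-dependent vector field, and ψ : ℝ → E → E a flow of V, meaning: ψ 0 = id, for all t and x the time derivative of s ↦ ψ s x at s = t equals V t (ψ t x), each map ψ t : E → E is a bijection, and both (t,x) ↦ ψ t x and (t,y) ↦ (ψ t)⁻¹ y are continuously differentiable. Let T > 0 and let λ > 0 be a constant such that ‖D(ψ t)ₓ v‖ ≥ λ⁻¹ ‖v‖ for all t ∈ [0,T], x ∈ E, v ∈ E, where D(ψ t)ₓ denotes the Fréchet derivative of ψ t at x. Then for every continuously differentiable path γ : [0,T] → E one has ‖γ 0 − (ψ T)⁻¹ (γ T)‖ ≤ λ · ∫₀ᵀ ‖γ'(t) − V t (γ t)‖ dt. -/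
/-!
Energy–distance inequality for flows (linear version of Proposition B.2 of
"The local Floer cohomology of indicator functions").

`V : ℝ → E → E` is a time-dependent vector field on a real normed vector space `E`,
with flow `ψ`: `ψ 0 = id`, `∂ₜ ψ (t, x) = V t (ψ t x)`; each `ψ t` is a bijection of `E`
(with inverse `ψinv t`), and `(t, x) ↦ ψ t x`, `(t, y) ↦ ψinv t y` are continuously
differentiable.  If `λ > 0` satisfies `‖D(ψ t)ₓ v‖ ≥ λ⁻¹ ‖v‖` for `t ∈ [0, T]`, then for
every `C¹` path `γ` one has
`‖γ 0 − (ψ T)⁻¹ (γ T)‖ ≤ λ · ∫₀ᵀ ‖γ' t − V t (γ t)‖ dt`.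
-/

/-- Slicing the derivative of an uncurried map `(t, x) ↦ ψ t x` in the time direction. -/
theorem fderiv_uncurry_apply_one_zero {E F : Type*} [NormedAddCommGroup E] [NormedSpace ℝ E]
    [NormedAddCommGroup F] [NormedSpace ℝ F] {ψ : ℝ → E → F} {t : ℝ} {x : E} {w : F}
    (hψ : DifferentiableAt ℝ (fun p : ℝ × E => ψ p.1 p.2) (t, x))
    (hw : HasDerivAt (fun s => ψ s x) w t) :
    fderiv ℝ (fun p : ℝ × E => ψ p.1 p.2) (t, x) (1, 0) = w := by
  have h := HasFDerivAt.comp_hasDerivAt (f := fun s => (s, x)) t hψ.hasFDerivAt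
    ((hasDerivAt_id t).prodMk (hasDerivAt_const t x))
  exact h.unique hw

/-- Slicing the derivative of an uncurried map `(t, x) ↦ ψ t x` in the space direction. -/
theorem fderiv_uncurry_apply_zero {E F : Type*} [NormedAddCommGroup E] [NormedSpace ℝ E]
    [NormedAddCommGroup F] [NormedSpace ℝ F] {ψ : ℝ → E → F} {t : ℝ} {x : E}
    (hψ : DifferentiableAt ℝ (fun p : ℝ × E => ψ p.1 p.2) (t, x)) (v : E) :
    fderiv ℝ (fun p : ℝ × E => ψ p.1 p.2) (t, x) (0, v) = fderiv ℝ (ψ t) x v := by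
  have h : HasFDerivAt (ψ t) _ x := hψ.hasFDerivAt.comp x (hasFDerivAt_prodMk_right t x)
  simp [h.fderiv]

/-- The chain rule for a curve `t ↦ ψ t (η t)` moving along with a flow. -/
theorem deriv_flow_comp {E F : Type*} [NormedAddCommGroup E] [NormedSpace ℝ E]
    [NormedAddCommGroup F] [NormedSpace ℝ F] {ψ : ℝ → E → F} {η : ℝ → E} {t : ℝ} {w : F}
    (hψ : DifferentiableAt ℝ (fun p : ℝ × E => ψ p.1 p.2) (t, η t))
    (hw : HasDerivAt (fun s => ψ s (η t)) w t) (hη : DifferentiableAt ℝ η t) :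
    deriv (fun s => ψ s (η s)) t = w + fderiv ℝ (ψ t) (η t) (deriv η t) := by
  have h : HasDerivAt (fun s => ψ s (η s)) _ t :=
    HasFDerivAt.comp_hasDerivAt (f := fun s => (s, η s)) t hψ.hasFDerivAt
      ((hasDerivAt_id t).prodMk hη.hasDerivAt)
  rw [h.deriv, ← fderiv_uncurry_apply_one_zero hψ hw, ← fderiv_uncurry_apply_zero hψ, ← map_add]
  simp

theorem energy_distance_inequality_for_flows
    {E : Type*} [NormedAddCommGroup E] [NormedSpace ℝ E]
    (V : ℝ → E → E) (ψ ψinv : ℝ → E → E)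
    (hψ0 : ∀ x : E, ψ 0 x = x)
    (hflow : ∀ (t : ℝ) (x : E), HasDerivAt (fun s => ψ s x) (V t (ψ t x)) t)
    (hleft : ∀ t : ℝ, Function.LeftInverse (ψinv t) (ψ t))
    (hright : ∀ t : ℝ, Function.RightInverse (ψinv t) (ψ t))
    (hsmooth : ContDiff ℝ 1 fun p : ℝ × E => ψ p.1 p.2)
    (hsmoothinv : ContDiff ℝ 1 fun p : ℝ × E => ψinv p.1 p.2)
    (T lam : ℝ) (hT : 0 < T) (hlam : 0 < lam)
    (hexp : ∀ t ∈ Set.Icc (0 : ℝ) T, ∀ x v : E, lam⁻¹ * ‖v‖ ≤ ‖fderiv ℝ (ψ t) x v‖)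
    (γ : ℝ → E) (hγ : ContDiff ℝ 1 γ) :
    ‖γ 0 - ψinv T (γ T)‖ ≤ lam * ∫ t in (0:ℝ)..T, ‖deriv γ t - V t (γ t)‖ := by
  set η : ℝ → E := fun t => ψinv t (γ t)
  have hη : ContDiff ℝ 1 η := hsmoothinv.comp (contDiff_id.prodMk hγ)
  have hηd : Differentiable ℝ η := hη.differentiable one_ne_zero
  have hψd := hsmooth.differentiable one_ne_zero
  have hψη : ∀ t, ψ t (η t) = γ t := fun t => hright t (γ t)
  have hη0 : η 0 = γ 0 := by rw [← hψ0 (η 0), hψη]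
  have hVγ : Continuous fun t => V t (γ t) := by
    have hV : ∀ t, V t (γ t) = fderiv ℝ (fun p : ℝ × E => ψ p.1 p.2) (t, η t) (1, 0) := by
      intro t
      rw [fderiv_uncurry_apply_one_zero (hψd _) (hflow t (η t)), hψη]
    simp only [hV]
    exact ((hsmooth.continuous_fderiv one_ne_zero).comp
      (continuous_id.prodMk hη.continuous)).clm_apply continuous_const
  have hγ' : ∀ t, deriv γ t - V t (γ t) = fderiv ℝ (ψ t) (η t) (deriv η t) := by
    intro t
    have h := deriv_flow_comp (hψd (t, η t)) (hflow t (η t)) (hηd t)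
    simp only [hψη] at h
    rw [h, add_sub_cancel_left]
  have hbound : ∀ t ∈ Set.Ioo 0 T, ‖deriv η t‖ ≤ lam * ‖deriv γ t - V t (γ t)‖ := by
    intro t ht
    rw [hγ', ← inv_mul_le_iff₀ hlam]
    exact hexp t (Set.Ioo_subset_Icc_self ht) (η t) (deriv η t)
  have hcont : Continuous fun t => lam * ‖deriv γ t - V t (γ t)‖ :=
    continuous_const.mul ((hγ.continuous_deriv le_rfl).sub hVγ).norm
  rw [← hη0, norm_sub_rev, ← intervalIntegral.integral_const_mul]
  exact norm_sub_le_integral_of_norm_deriv_le_of_le hT.le hη.continuous.continuousOn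
    hηd.differentiableOn (.of_forall hbound) (hcont.intervalIntegrable 0 T)
end

section
/- Energy–distance inequality for loops (linear version of the first part of Proposition B.3). Let E be a real normed vector space, V : ℝ → E → E a time-dependent vector field with flow ψ as above (ψ 0 = id, ∂ₜ ψ(t,x) = V t (ψ t x), each ψ t bijective, (t,x) ↦ ψ t x and (t,y) ↦ (ψ t)⁻¹ y continuously differentiable). Suppose λ > 0 satisfies ‖D(ψ t)ₓ v‖ ≥ λ⁻¹ ‖v‖ for all t ∈ [0,1], x, v, and suppose ψ 1 is L-Lipschitz for some L > 0. Then for every continuously differentiable loop γ : [0,1] → E with γ 1 = γ 0 one has ‖γ 0 − ψ 1 (γ 0)‖ ≤ L · λ · (∫₀¹ ‖γ'(t) − V t (γ t)‖² dt)^{1/2}. -/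
/-!
Energy–distance inequality for loops (linear version of the first part of
Proposition B.3 of "The local Floer cohomology of indicator functions").

`V : ℝ → E → E` is a time-dependent vector field on a real normed vector space `E`,
with flow `ψ` (`ψ 0 = id`, `∂ₜ ψ (t, x) = V t (ψ t x)`, each `ψ t` bijective with inverse
`ψinv t`, both `(t,x) ↦ ψ t x` and `(t,y) ↦ ψinv t y` continuously differentiable).
If `λ > 0` satisfies `‖D(ψ t)ₓ v‖ ≥ λ⁻¹ ‖v‖` for `t ∈ [0,1]` and `ψ 1` is `L`-Lipschitz,
then for every `C¹` loop `γ` (`γ 1 = γ 0`) one has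
`‖γ 0 − ψ 1 (γ 0)‖ ≤ L · λ · (∫₀¹ ‖γ' t − V t (γ t)‖² dt)^{1/2}`.
-/

/-- The displacement of a `C¹` curve is at most the integral of any continuous bound on its speed;
the codomain need not be complete. -/
theorem norm_sub_le_integral_of_norm_deriv_le_continuous
    {E : Type*} [NormedAddCommGroup E] [NormedSpace ℝ E] {c : ℝ → E} {g : ℝ → ℝ} {a b : ℝ}
    (hab : a ≤ b) (hc : Differentiable ℝ c) (hg : Continuous g)
    (hbound : ∀ t ∈ Set.Icc a b, ‖deriv c t‖ ≤ g t) :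
    ‖c b - c a‖ ≤ ∫ t in a..b, g t :=
  image_norm_le_of_norm_deriv_right_le_deriv_boundary
    (f := fun t => c t - c a) (f' := deriv c) (B := fun t => ∫ s in a..t, g s) (B' := g)
    (hc.continuous.sub continuous_const).continuousOn
    (fun t _ => ((hc t).hasDerivAt.sub_const _).hasDerivWithinAt)
    (by simp) (fun t => hg.integral_hasStrictDerivAt a t |>.hasDerivAt)
    (fun t ht => hbound t (Set.Ico_subset_Icc_self ht)) (Set.right_mem_Icc.2 hab)

/-- The `L¹`–`L²` inequality on the unit interval. -/
theorem integral_le_sqrt_integral_sq {g : ℝ → ℝ} (hg : Continuous g) :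
    ∫ t in (0 : ℝ)..1, g t ≤ Real.sqrt (∫ t in (0 : ℝ)..1, g t ^ 2) := by
  apply Real.le_sqrt_of_sq_le
  set m := ∫ t in (0 : ℝ)..1, g t with hm
  have hnonneg : 0 ≤ ∫ t in (0 : ℝ)..1, (g t - m) ^ 2 :=
    intervalIntegral.integral_nonneg zero_le_one fun t _ => sq_nonneg _
  have hexpand : ∫ t in (0 : ℝ)..1, (g t - m) ^ 2 =
      (∫ t in (0 : ℝ)..1, g t ^ 2) - 2 * m * m + m ^ 2 := by
    have hsq : ∀ t, (g t - m) ^ 2 = g t ^ 2 - 2 * m * g t + m ^ 2 := fun t => by ring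
    simp_rw [hsq]
    rw [intervalIntegral.integral_add, intervalIntegral.integral_sub,
      intervalIntegral.integral_const_mul, ← hm]
    · simp
    all_goals exact Continuous.intervalIntegrable (by fun_prop) _ _
  nlinarith

theorem energy_distance_inequality_for_loops
    {E : Type*} [NormedAddCommGroup E] [NormedSpace ℝ E]
    (V : ℝ → E → E) (ψ ψinv : ℝ → E → E)
    (hψ0 : ∀ x : E, ψ 0 x = x)
    (hflow : ∀ (t : ℝ) (x : E), HasDerivAt (fun s => ψ s x) (V t (ψ t x)) t)
    (hleft : ∀ t : ℝ, Function.LeftInverse (ψinv t) (ψ t))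
    (hright : ∀ t : ℝ, Function.RightInverse (ψinv t) (ψ t))
    (hsmooth : ContDiff ℝ 1 fun p : ℝ × E => ψ p.1 p.2)
    (hsmoothinv : ContDiff ℝ 1 fun p : ℝ × E => ψinv p.1 p.2)
    (lam L : ℝ) (hlam : 0 < lam) (hL : 0 < L)
    (hexp : ∀ t ∈ Set.Icc (0 : ℝ) 1, ∀ x v : E, lam⁻¹ * ‖v‖ ≤ ‖fderiv ℝ (ψ t) x v‖)
    (hLip : ∀ x y : E, ‖ψ 1 x - ψ 1 y‖ ≤ L * ‖x - y‖)
    (γ : ℝ → E) (hγ : ContDiff ℝ 1 γ) (hloop : γ 1 = γ 0) :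
    ‖γ 0 - ψ 1 (γ 0)‖ ≤
      L * lam * Real.sqrt (∫ t in (0:ℝ)..1, ‖deriv γ t - V t (γ t)‖ ^ 2) := by
  set c : ℝ → E := fun t => ψinv t (γ t)
  have hc : ContDiff ℝ 1 c := hsmoothinv.comp (contDiff_id.prodMk hγ)
  have hψc : ∀ t, ψ t (c t) = γ t := fun t => hright t (γ t)
  have hc' : Differentiable ℝ c := hc.differentiable one_ne_zero
  have hψ : Differentiable ℝ fun p : ℝ × E => ψ p.1 p.2 := hsmooth.differentiable one_ne_zero
  set D : ℝ → ℝ × E →L[ℝ] E := fun t => fderiv ℝ (fun p : ℝ × E => ψ p.1 p.2) (t, c t) with hD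
  have hV : ∀ t, V t (γ t) = D t (1, 0) := fun t => by
    have h := (hψ (t, c t)).hasFDerivAt.comp_hasDerivAt t
      ((hasDerivAt_id t).prodMk (hasDerivAt_const t (c t)))
    rw [← hψc t]
    exact (hflow t (c t)).unique h
  have hspace : ∀ t v, fderiv ℝ (ψ t) (c t) v = D t (0, v) := fun t v => by
    have h := (hψ (t, c t)).hasFDerivAt.comp (c t)
      ((hasFDerivAt_const t (c t)).prodMk (hasFDerivAt_id (c t)))
    have h' : HasFDerivAt (ψ t) _ (c t) := h
    rw [h'.fderiv]
    simp [hD]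
  have hdefect : ∀ t, deriv γ t - V t (γ t) = fderiv ℝ (ψ t) (c t) (deriv c t) := fun t => by
    have hcomp := (hψ (t, c t)).hasFDerivAt.comp_hasDerivAt t
      ((hasDerivAt_id t).prodMk (hc' t).hasDerivAt)
    have h : HasDerivAt (fun s => ψ s (c s)) (D t (1, deriv c t)) t := hcomp
    simp_rw [hψc] at h
    rw [h.deriv, hV, hspace, ← map_sub]
    simp
  have hcont : Continuous fun t => ‖deriv γ t - V t (γ t)‖ := by
    have hDcont : Continuous D :=
      (hsmooth.continuous_fderiv one_ne_zero).comp (continuous_id.prodMk hc.continuous)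
    simp_rw [hV]
    exact ((hγ.continuous_deriv le_rfl).sub (hDcont.clm_apply continuous_const)).norm
  have hspeed : ∀ t ∈ Set.Icc (0 : ℝ) 1, ‖deriv c t‖ ≤ lam * ‖deriv γ t - V t (γ t)‖ :=
    fun t ht => by
      rw [hdefect, ← inv_mul_le_iff₀ hlam]
      exact hexp t ht _ _
  have hc0 : c 0 = γ 0 := by rw [← hψ0 (c 0), hψc]
  calc ‖γ 0 - ψ 1 (γ 0)‖ = ‖ψ 1 (c 1) - ψ 1 (c 0)‖ := by rw [hψc, hloop, hc0]
    _ ≤ L * ‖c 1 - c 0‖ := hLip _ _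
    _ ≤ L * (lam * ∫ t in (0 : ℝ)..1, ‖deriv γ t - V t (γ t)‖) := by
      rw [← intervalIntegral.integral_const_mul]
      gcongr
      exact norm_sub_le_integral_of_norm_deriv_le_continuous zero_le_one hc'
        (continuous_const.mul hcont) hspeed
    _ ≤ L * (lam * Real.sqrt (∫ t in (0 : ℝ)..1, ‖deriv γ t - V t (γ t)‖ ^ 2)) := by
      gcongr
      exact integral_le_sqrt_integral_sq hcont
    _ = _ := (mul_assoc _ _ _).symm
end

section
/- Energy–distance inequality for paths of a time-independent flow (linear version of the second part of Proposition B.3). Let E be a real normed vector space, V : E → E a (time-independent) vector field with flow ψ : ℝ → E → E (ψ 0 = id, ∂ₜ ψ(t,x) = V (ψ t x), each ψ t bijective, (t,x) ↦ ψ t x and (t,y) ↦ (ψ t)⁻¹ y continuously differentiable). Let T > 0 and c ≥ 0 be such that for all t ∈ [0,T]: ‖D(ψ t)ₓ v‖ ≥ e^{−ct} ‖v‖ for all x, v, and ψ T is e^{cT}-Lipschitz. Then for every continuously differentiable path γ : [0,T] → E one has ‖γ T − ψ T (γ 0)‖ ≤ √T · e^{2cT} · (∫₀ᵀ ‖γ'(t)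 − V (γ t)‖² dt)^{1/2}. -/
/-!
Energy–distance inequality for paths of a time-independent flow (linear version of the
second part of Proposition B.3 of "The local Floer cohomology of indicator functions").

`V : E → E` is a time-independent vector field on a real normed vector space `E`, with
flow `ψ` (`ψ 0 = id`, `∂ₜ ψ (t, x) = V (ψ t x)`, each `ψ t` bijective with inverse
`ψinv t`, both `(t,x) ↦ ψ t x` and `(t,y) ↦ ψinv t y` continuously differentiable).
If for all `t ∈ [0,T]` one has `‖D(ψ t)ₓ v‖ ≥ e^{−ct} ‖v‖` and `ψ T` is
`e^{cT}`-Lipschitz, then for every `C¹` path `γ` one has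
`‖γ T − ψ T (γ 0)‖ ≤ √T · e^{2cT} · (∫₀ᵀ ‖γ' t − V (γ t)‖² dt)^{1/2}`.
-/

/-- Cauchy–Schwarz against the constant function `1` on an interval. -/
theorem intervalIntegral_le_sqrt_mul_sqrt_integral_sq {f : ℝ → ℝ} (hf : Continuous f)
    {T : ℝ} (hT : 0 < T) :
    ∫ t in (0 : ℝ)..T, f t ≤ √T * √(∫ t in (0 : ℝ)..T, f t ^ 2) := by
  rw [← Real.sqrt_mul hT.le]
  apply Real.le_sqrt_of_sq_le
  set I := ∫ t in (0 : ℝ)..T, f t with hI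
  have hnonneg : 0 ≤ ∫ t in (0 : ℝ)..T, (f t - I / T) ^ 2 :=
    intervalIntegral.integral_nonneg hT.le fun t _ => sq_nonneg _
  have hexpand : ∫ t in (0 : ℝ)..T, (f t - I / T) ^ 2 =
      (∫ t in (0 : ℝ)..T, f t ^ 2) - I ^ 2 / T := by
    have hsq : ∀ t, (f t - I / T) ^ 2 = f t ^ 2 - 2 * (I / T) * f t + (I / T) ^ 2 :=
      fun t => by ring
    simp_rw [hsq]
    rw [intervalIntegral.integral_add, intervalIntegral.integral_sub,
      intervalIntegral.integral_const_mul, ← hI, intervalIntegral.integral_const]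
    · simp only [smul_eq_mul, sub_zero]
      field_simp
      ring
    all_goals exact Continuous.intervalIntegrable (by fun_prop) _ _
  rw [hexpand, sub_nonneg, div_le_iff₀ hT] at hnonneg
  linarith

/-- The mean value inequality in integral form, in a possibly incomplete space. -/
theorem norm_sub_le_intervalIntegral_of_norm_deriv_le {E : Type*} [NormedAddCommGroup E]
    [NormedSpace ℝ E] {f f' : ℝ → E} {g : ℝ → ℝ} {T : ℝ} (hT : 0 ≤ T)
    (hf : ∀ t, HasDerivAt f (f' t) t) (hg : Continuous g)
    (hbound : ∀ t ∈ Set.Icc 0 T, ‖f' t‖ ≤ g t) :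
    ‖f T - f 0‖ ≤ ∫ t in (0 : ℝ)..T, g t :=
  image_norm_le_of_norm_deriv_right_le_deriv_boundary (f := fun t => f t - f 0) (f' := f')
    (B := fun t => ∫ s in (0 : ℝ)..t, g s) (B' := g)
    (fun t _ => ((hf t).sub_const _).continuousAt.continuousWithinAt)
    (fun t _ => ((hf t).sub_const _).hasDerivWithinAt) (by simp)
    (fun t => intervalIntegral.integral_hasDerivAt_right (hg.intervalIntegrable _ _)
      (hg.stronglyMeasurableAtFilter _ _) hg.continuousAt)
    (fun t ht => hbound t (Set.Ico_subset_Icc_self ht)) (Set.right_mem_Icc.2 hT)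

/-- The time derivative of a flow of `V`, read off from its total derivative. -/
theorem fderiv_flow_apply_time {E : Type*} [NormedAddCommGroup E] [NormedSpace ℝ E]
    {V : E → E} {ψ : ℝ → E → E}
    (hflow : ∀ (t : ℝ) (x : E), HasDerivAt (fun s => ψ s x) (V (ψ t x)) t)
    (hψ : Differentiable ℝ fun p : ℝ × E => ψ p.1 p.2) (t : ℝ) (x : E) :
    fderiv ℝ (fun p : ℝ × E => ψ p.1 p.2) (t, x) (1, 0) = V (ψ t x) := by
  have h := (hψ (t, x)).hasFDerivAt.comp_hasDerivAt t
    ((hasDerivAt_id t).prodMk (hasDerivAt_const t x))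
  exact HasDerivAt.unique (f := fun s => ψ s x) h (hflow t x)

/-- The derivative of `t ↦ ψ t (β t)` for a flow `ψ` of `V`. -/
theorem hasDerivAt_flow_comp {E : Type*} [NormedAddCommGroup E] [NormedSpace ℝ E]
    {V : E → E} {ψ : ℝ → E → E}
    (hflow : ∀ (t : ℝ) (x : E), HasDerivAt (fun s => ψ s x) (V (ψ t x)) t)
    (hψ : Differentiable ℝ fun p : ℝ × E => ψ p.1 p.2)
    {β : ℝ → E} {β' : E} {t : ℝ} (hβ : HasDerivAt β β' t) :
    HasDerivAt (fun s => ψ s (β s)) (V (ψ t (β t)) + fderiv ℝ (ψ t) (β t) β') t := by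
  have hF := (hψ (t, β t)).hasFDerivAt
  have htime := fderiv_flow_apply_time hflow hψ t (β t)
  have hspace : fderiv ℝ (ψ t) (β t) β' =
      fderiv ℝ (fun p : ℝ × E => ψ p.1 p.2) (t, β t) (0, β') := by
    have h : HasFDerivAt (ψ t) _ (β t) := hF.comp (β t) (hasFDerivAt_prodMk_right t (β t))
    rw [h.fderiv]
    simp
  have h := hF.comp_hasDerivAt t ((hasDerivAt_id t).prodMk hβ)
  rw [hspace, ← htime, ← map_add, Prod.mk_add_mk, add_zero, zero_add]
  exact h

/-- The generator of a continuously differentiable flow is continuous. -/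
theorem continuous_of_contDiff_flow {E : Type*} [NormedAddCommGroup E] [NormedSpace ℝ E]
    {V : E → E} {ψ : ℝ → E → E} (hψ0 : ∀ x : E, ψ 0 x = x)
    (hflow : ∀ (t : ℝ) (x : E), HasDerivAt (fun s => ψ s x) (V (ψ t x)) t)
    (hψ : ContDiff ℝ 1 fun p : ℝ × E => ψ p.1 p.2) : Continuous V := by
  have hV : V = fun x => fderiv ℝ (fun p : ℝ × E => ψ p.1 p.2) (0, x) (1, 0) := by
    funext x
    rw [fderiv_flow_apply_time hflow (hψ.differentiable one_ne_zero), hψ0]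
  rw [hV]
  exact ((hψ.continuous_fderiv one_ne_zero).comp (by fun_prop)).clm_apply continuous_const

theorem energy_distance_inequality_autonomous
    {E : Type*} [NormedAddCommGroup E] [NormedSpace ℝ E]
    (V : E → E) (ψ ψinv : ℝ → E → E)
    (hψ0 : ∀ x : E, ψ 0 x = x)
    (hflow : ∀ (t : ℝ) (x : E), HasDerivAt (fun s => ψ s x) (V (ψ t x)) t)
    (hleft : ∀ t : ℝ, Function.LeftInverse (ψinv t) (ψ t))
    (hright : ∀ t : ℝ, Function.RightInverse (ψinv t) (ψ t))
    (hsmooth : ContDiff ℝ 1 fun p : ℝ × E => ψ p.1 p.2)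
    (hsmoothinv : ContDiff ℝ 1 fun p : ℝ × E => ψinv p.1 p.2)
    (T c : ℝ) (hT : 0 < T) (hc : 0 ≤ c)
    (hexp : ∀ t ∈ Set.Icc (0 : ℝ) T, ∀ x v : E,
      Real.exp (-(c * t)) * ‖v‖ ≤ ‖fderiv ℝ (ψ t) x v‖)
    (hLip : ∀ x y : E, ‖ψ T x - ψ T y‖ ≤ Real.exp (c * T) * ‖x - y‖)
    (γ : ℝ → E) (hγ : ContDiff ℝ 1 γ) :
    ‖γ T - ψ T (γ 0)‖ ≤
      Real.sqrt T * Real.exp (2 * c * T) *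
        Real.sqrt (∫ t in (0:ℝ)..T, ‖deriv γ t - V (γ t)‖ ^ 2) := by
  have hVcont := continuous_of_contDiff_flow hψ0 hflow hsmooth
  have hγ'cont : Continuous (deriv γ) := hγ.continuous_deriv le_rfl
  set g : ℝ → ℝ := fun t => ‖deriv γ t - V (γ t)‖ with hg
  have hgcont : Continuous g := (hγ'cont.sub (hVcont.comp hγ.continuous)).norm
  set β : ℝ → E := fun t => ψinv t (γ t) with hβ
  have hβdiff : Differentiable ℝ β :=
    (hsmoothinv.comp (contDiff_id.prodMk hγ)).differentiable one_ne_zero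
  have hψβ : ∀ t, ψ t (β t) = γ t := fun t => hright t (γ t)
  have hβ0 : β 0 = γ 0 := by rw [← hψ0 (β 0), hψβ]
  have hβ' : ∀ t ∈ Set.Icc 0 T, ‖deriv β t‖ ≤ Real.exp (c * T) * g t := by
    intro t ht
    have hd := hasDerivAt_flow_comp hflow (hsmooth.differentiable one_ne_zero)
      (hβdiff t).hasDerivAt
    simp only [hψβ] at hd
    have hlow := hexp t ht (β t) (deriv β t)
    rw [← sub_eq_of_eq_add' hd.deriv, Real.exp_neg, inv_mul_le_iff₀ (Real.exp_pos _)] at hlow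
    refine hlow.trans ?_
    gcongr
    exact ht.2
  calc ‖γ T - ψ T (γ 0)‖ = ‖ψ T (β T) - ψ T (β 0)‖ := by rw [hψβ, hβ0]
    _ ≤ Real.exp (c * T) * ‖β T - β 0‖ := hLip _ _
    _ ≤ Real.exp (c * T) * ∫ t in (0 : ℝ)..T, Real.exp (c * T) * g t := by
      gcongr
      exact norm_sub_le_intervalIntegral_of_norm_deriv_le hT.le
        (fun t => (hβdiff t).hasDerivAt) (by fun_prop) hβ'
    _ ≤ Real.exp (c * T) * (Real.exp (c * T) * (√T * √(∫ t in (0 : ℝ)..T, g t ^ 2))) := by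
      rw [intervalIntegral.integral_const_mul]
      gcongr
      exact intervalIntegral_le_sqrt_mul_sqrt_integral_sq hgcont hT
    _ = √T * Real.exp (2 * c * T) * √(∫ t in (0 : ℝ)..T, g t ^ 2) := by
      rw [show 2 * c * T = c * T + c * T by ring, Real.exp_add]
      ring
end

section
/- Lemma 7.2 (torsion-freeness implies injectivity from infinitesimal cohomology), concrete form. Let K be a Novikov-type field with valuation ring O, and let (C, d, ‖·‖) be a Banach complex over K. Suppose H(B₀) is torsion-free over O. Then for all real numbers t < 0 and ε > 0 with t + ε ≤ 0, the natural map H(B_{t+ε}/B_t) → H(B₀/B_t) is injective. Concretely: for every x ∈ C with ‖x‖ < e^{t+ε} and ‖d x‖ < e^{t}, if there exists y ∈ C with ‖y‖ < 1 and ‖x − d y‖ < e^{t}, then there exists y' ∈ C with ‖y'‖ < e^{t+ε} and ‖x − d y'‖ < e^{t}. -/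
/-!
Lemma 7.2 of "The local Floer cohomology of indicator functions"
(torsion-freeness implies injectivity from infinitesimal cohomology), concrete form.

A Novikov-type field is a field `K` with a nonarchimedean absolute value `v : K → ℝ`
whose value group is all of `ℝ`; its valuation ring is `O = {a : v a ≤ 1}`.  A Banach
complex over `K` is a `K`-vector space `C` with a complete nonarchimedean norm `N` and a
`K`-linear differential `d` with `d ∘ d = 0` and `N (d x) ≤ N x`.  For `t : ℝ`,
`B_t = {x : N x < e^t}`.  If `H(B₀)` is torsion-free over `O`, then for `t < 0`,
`0 < ε`, `t + ε ≤ 0`, the natural map `H(B_{t+ε}/B_t) → H(B₀/B_t)` is injective;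
concretely: for every `x` with `N x < e^{t+ε}` and `N (d x) < e^t`, if there is `y` with
`N y < 1` and `N (x − d y) < e^t`, then there is `y'` with `N y' < e^{t+ε}` and
`N (x − d y') < e^t`.
-/

/-- A nonarchimedean absolute value on a field whose value group is all of `ℝ`. -/
structure IsNovikovAbs {K : Type*} [Field K] (v : K → ℝ) : Prop where
  nonneg : ∀ a : K, 0 ≤ v a
  eq_zero_iff : ∀ a : K, v a = 0 ↔ a = 0
  map_mul : ∀ a b : K, v (a * b) = v a * v b
  add_le : ∀ a b : K, v (a + b) ≤ max (v a) (v b)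
  surj : ∀ r : ℝ, 0 < r → ∃ a : K, v a = r

/-- A Banach complex over a Novikov-type field: a complete nonarchimedean norm `N`
compatible with the absolute value `v`, and a norm-nonincreasing square-zero
differential `d`. -/
structure IsBanachComplex {K C : Type*} [Field K] [AddCommGroup C] [Module K C]
    (v : K → ℝ) (N : C → ℝ) (d : C →ₗ[K] C) : Prop where
  nonneg : ∀ x : C, 0 ≤ N x
  eq_zero_iff : ∀ x : C, N x = 0 ↔ x = 0
  smul : ∀ (a : K) (x : C), N (a • x) = v a * N x
  add_le : ∀ x y : C, N (x + y) ≤ max (N x) (N y)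
  complete : ∀ f : ℕ → C,
    (∀ ε : ℝ, 0 < ε → ∃ M : ℕ, ∀ m ≥ M, ∀ n ≥ M, N (f m - f n) < ε) →
    ∃ l : C, ∀ ε : ℝ, 0 < ε → ∃ M : ℕ, ∀ n ≥ M, N (f n - l) < ε
  d_sq : ∀ x : C, d (d x) = 0
  d_le : ∀ x : C, N (d x) ≤ N x

theorem IsNovikovAbs.map_one {K : Type*} [Field K] {v : K → ℝ} (hv : IsNovikovAbs v) :
    v 1 = 1 := by
  have h0 : v 1 ≠ 0 := fun h => one_ne_zero ((hv.eq_zero_iff 1).1 h)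
  have h : v 1 * v 1 = v 1 * 1 := by rw [← hv.map_mul, mul_one, mul_one]
  exact mul_left_cancel₀ h0 h

theorem IsNovikovAbs.map_neg_one {K : Type*} [Field K] {v : K → ℝ} (hv : IsNovikovAbs v) :
    v (-1) = 1 := by
  have h : v (-1) * v (-1) = 1 := by rw [← hv.map_mul, neg_one_mul, neg_neg, hv.map_one]
  nlinarith [hv.nonneg (-1)]

theorem IsBanachComplex.sub_le {K C : Type*} [Field K] [AddCommGroup C] [Module K C]
    {v : K → ℝ} {N : C → ℝ} {d : C →ₗ[K] C} (hv : IsNovikovAbs v)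
    (hN : IsBanachComplex v N d) (x y : C) : N (x - y) ≤ max (N x) (N y) := by
  have h := hN.add_le x ((-1 : K) • y)
  rwa [hN.smul, hv.map_neg_one, one_mul, neg_one_smul, ← sub_eq_add_neg] at h

/-- If `H(B₀)` is torsion-free, a boundary `d y` of an element `y ∈ B₀` which has norm less than
`r ≤ 1` is the boundary of an element of norm less than `r`. -/
theorem IsBanachComplex.exists_primitive_of_torsionFree
    {K C : Type*} [Field K] [AddCommGroup C] [Module K C]
    {v : K → ℝ} {N : C → ℝ} {d : C →ₗ[K] C}
    (hv : IsNovikovAbs v) (hN : IsBanachComplex v N d)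
    (htf : ∀ z : C, N z < 1 → d z = 0 →
      (∃ a : K, a ≠ 0 ∧ v a ≤ 1 ∧ ∃ y : C, N y < 1 ∧ d y = a • z) →
      ∃ y : C, N y < 1 ∧ d y = z)
    {r : ℝ} (hr : 0 < r) (hr1 : r ≤ 1) {y : C} (hy : N y < 1) (hdy : N (d y) < r) :
    ∃ y' : C, N y' < r ∧ d y' = d y := by
  obtain ⟨b, hb⟩ := hv.surj r hr
  have hb0 : b ≠ 0 := fun h => hr.ne' (hb ▸ (hv.eq_zero_iff b).2 h)
  have hbz : b • b⁻¹ • d y = d y := smul_inv_smul₀ hb0 _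
  have hz : N (b⁻¹ • d y) < 1 := by
    have h := hN.smul b (b⁻¹ • d y)
    rw [hbz, hb] at h
    nlinarith
  obtain ⟨w, hw, hdw⟩ := htf (b⁻¹ • d y) hz (by rw [map_smul, hN.d_sq, smul_zero])
    ⟨b, hb0, hb.trans_le hr1, y, hy, hbz.symm⟩
  refine ⟨b • w, ?_, by rw [map_smul, hdw, hbz]⟩
  rw [hN.smul, hb]
  exact mul_lt_of_lt_one_right hr hw

theorem torsionFree_implies_injective_from_infinitesimal
    {K C : Type*} [Field K] [AddCommGroup C] [Module K C]
    (v : K → ℝ) (N : C → ℝ) (d : C →ₗ[K] C)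
    (hv : IsNovikovAbs v) (hN : IsBanachComplex v N d)
    -- `H(B₀)` is torsion-free over the valuation ring `O = {a : v a ≤ 1}`:
    (htf : ∀ z : C, N z < 1 → d z = 0 →
      (∃ a : K, a ≠ 0 ∧ v a ≤ 1 ∧ ∃ y : C, N y < 1 ∧ d y = a • z) →
      ∃ y : C, N y < 1 ∧ d y = z)
    (t ε : ℝ) (ht : t < 0) (hε : 0 < ε) (hte : t + ε ≤ 0)
    (x : C) (hx : N x < Real.exp (t + ε)) (hdx : N (d x) < Real.exp t)
    (hbdry : ∃ y : C, N y < 1 ∧ N (x - d y) < Real.exp t) :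
    ∃ y' : C, N y' < Real.exp (t + ε) ∧ N (x - d y') < Real.exp t := by
  obtain ⟨y, hy, hxy⟩ := hbdry
  have hdy : N (d y) < Real.exp (t + ε) := by
    have h := hN.sub_le hv x (x - d y)
    rw [sub_sub_cancel] at h
    exact h.trans_lt (max_lt hx (hxy.trans (Real.exp_lt_exp.2 (lt_add_of_pos_right t hε))))
  obtain ⟨y', hy', hdy'⟩ := hN.exists_primitive_of_torsionFree hv htf
    (Real.exp_pos _) (Real.exp_le_one_iff.2 hte) hy hdy
  exact ⟨y', hy', by rwa [hdy']⟩
end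

section
/- Identification of the norm filtration on homology with truncated homology under torsion-freeness (the claim V_b/V_a ≅ H(B_b/B_a) proved inside Lemma 7.6). Let K be a Novikov-type field with valuation ring O, and let (C, d, ‖·‖) be a Banach complex over K such that H(B₀) is torsion-free over O. Let H := ker d / im d, a K-vector space, equipped with the quotient seminorm |h| := inf { ‖x‖ : x ∈ C, d x = 0, [x] = h }. For s ∈ ℝ set V_s := { h ∈ H : |h| < e^{s} }, an O-submodule of H. Then for all real a < b: (1) the assignment sending h ∈ V_b to the class in H(B_b/B_a) of any cycle representative x of h with ‖x‖ < e^{b} is well defined (independent of the chosen representative) and O-linear; (2) this map is surjective and its kernel is exactly V_a; hence it induces an isomorphism of O-modules V_b/V_a ≅ H(B_b/B_a). -/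
namespace IsBanachComplex

variable {K C : Type*} [Field K] [AddCommGroup C] [Module K C]
  {v : K → ℝ} {N : C → ℝ} {d : C →ₗ[K] C}

theorem map_zero (hN : IsBanachComplex v N d) : N 0 = 0 :=
  (hN.eq_zero_iff 0).2 rfl

theorem sub_lt (hv : IsNovikovAbs v) (hN : IsBanachComplex v N d) {x y : C} {r : ℝ}
    (hx : N x < r) (hy : N y < r) : N (x - y) < r := by
  have h1 : v 1 = 1 := by
    have h := hv.map_mul 1 1
    have h0 : v 1 ≠ 0 := fun h => one_ne_zero ((hv.eq_zero_iff 1).1 h)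
    rw [mul_one] at h
    exact mul_left_cancel₀ h0 (by rw [← h, mul_one])
  have hneg : v (-1) = 1 := by
    have h := hv.map_mul (-1) (-1)
    rw [neg_mul_neg, mul_one, h1] at h
    nlinarith [hv.nonneg (-1)]
  have hNy : N (-y) = N y := by
    rw [← neg_one_smul K y, hN.smul, hneg, one_mul]
  rw [sub_eq_add_neg]
  exact (hN.add_le _ _).trans_lt (max_lt hx (hNy ▸ hy))

/-- If the homology of the open unit ball is torsion-free, every boundary of norm `< r` has a
primitive of norm `< r`. -/
theorem exists_primitive_lt (hv : IsNovikovAbs v) (hN : IsBanachComplex v N d)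
    (htf : ∀ z : C, N z < 1 → d z = 0 →
      (∃ a : K, a ≠ 0 ∧ v a ≤ 1 ∧ ∃ y : C, N y < 1 ∧ d y = a • z) →
      ∃ y : C, N y < 1 ∧ d y = z)
    {r : ℝ} (hr : 0 < r) (w : C) (hw : N (d w) < r) : ∃ y : C, N y < r ∧ d y = d w := by
  have ne_zero_of_pos : ∀ {a : K}, 0 < v a → a ≠ 0 := fun ha h =>
    ha.ne' ((hv.eq_zero_iff _).2 h)
  obtain ⟨c, hc⟩ := hv.surj r hr
  have hc0 : c ≠ 0 := ne_zero_of_pos (hc ▸ hr)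
  have norm_smul : ∀ x : C, N x = r * N (c⁻¹ • x) := fun x => by
    rw [← hc, ← hN.smul, smul_inv_smul₀ hc0]
  set w' := c⁻¹ • w with hw'
  have hpos : 0 < 1 + N w' := by linarith [hN.nonneg w']
  obtain ⟨a, ha⟩ := hv.surj (1 + N w')⁻¹ (inv_pos.2 hpos)
  obtain ⟨y, hy, hdy⟩ := htf (d w')
    (by
      rw [norm_smul, ← map_smul, ← hw'] at hw
      exact (mul_lt_iff_lt_one_right hr).1 hw)
    (hN.d_sq _)
    ⟨a, ne_zero_of_pos (ha ▸ inv_pos.2 hpos),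
      ha ▸ inv_le_one_of_one_le₀ (by linarith [hN.nonneg w']), a • w', by
        rw [hN.smul, ha, inv_mul_lt_one₀ hpos]
        linarith, map_smul _ _ _⟩
  refine ⟨c • y, ?_, ?_⟩
  · rw [hN.smul, hc]
    exact (mul_lt_iff_lt_one_right hr).2 hy
  · rw [map_smul, hdy, hw', map_smul, smul_inv_smul₀ hc0]

end IsBanachComplex

theorem norm_filtration_eq_truncated_homology
    {K C : Type*} [Field K] [AddCommGroup C] [Module K C]
    (v : K → ℝ) (N : C → ℝ) (d : C →ₗ[K] C)
    (hv : IsNovikovAbs v) (hN : IsBanachComplex v N d)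
    -- `H(B₀)` is torsion-free over the valuation ring `O = {a : v a ≤ 1}`:
    (htf : ∀ z : C, N z < 1 → d z = 0 →
      (∃ a : K, a ≠ 0 ∧ v a ≤ 1 ∧ ∃ y : C, N y < 1 ∧ d y = a • z) →
      ∃ y : C, N y < 1 ∧ d y = z)
    (a b : ℝ) (hab : a < b) :
    -- (1) the map `V_b → H(B_b/B_a)` is well defined: two cycle representatives of
    -- norm `< e^b` of the same homology class have equal classes in `H(B_b/B_a)`:
    (∀ x x' : C, d x = 0 → d x' = 0 → N x < Real.exp b → N x' < Real.exp b →
      (∃ w : C, d w = x - x') →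
      ∃ y z : C, N y < Real.exp b ∧ N z < Real.exp a ∧ x - x' = d y + z)
    ∧
    -- (2a) surjectivity: every class of `H(B_b/B_a)` is hit by a cycle of norm `< e^b`:
    (∀ x : C, N x < Real.exp b → N (d x) < Real.exp a →
      ∃ x' : C, d x' = 0 ∧ N x' < Real.exp b ∧
        ∃ y z : C, N y < Real.exp b ∧ N z < Real.exp a ∧ x - x' = d y + z)
    ∧
    -- (2b) the kernel is exactly `V_a`: a cycle `x` of norm `< e^b` has vanishing class
    -- in `H(B_b/B_a)` iff its homology class has seminorm `< e^a`, i.e. iff it admits a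
    -- cycle representative of norm `< e^a`:
    (∀ x : C, d x = 0 → N x < Real.exp b →
      ((∃ y z : C, N y < Real.exp b ∧ N z < Real.exp a ∧ x = d y + z) ↔
        (∃ x'' : C, d x'' = 0 ∧ N x'' < Real.exp a ∧ ∃ w : C, d w = x - x''))) := by
  refine ⟨?_, ?_, ?_⟩
  · rintro x x' - - hx hx' ⟨w, hw⟩
    obtain ⟨y, hy, hdy⟩ := hN.exists_primitive_lt hv htf (Real.exp_pos b) w
      (hw ▸ hN.sub_lt hv hx hx')
    exact ⟨y, 0, hy, hN.map_zero ▸ Real.exp_pos a, by rw [hdy, hw, add_zero]⟩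
  · intro x hx hdx
    obtain ⟨y, hy, hdy⟩ := hN.exists_primitive_lt hv htf (Real.exp_pos a) x hdx
    exact ⟨x - y, by rw [map_sub, hdy, sub_self],
      hN.sub_lt hv hx (hy.trans (Real.exp_lt_exp.2 hab)), 0, y,
      hN.map_zero ▸ Real.exp_pos b, hy, by rw [_root_.map_zero, zero_add, sub_sub_cancel]⟩
  · intro x hdx hx
    constructor
    · rintro ⟨y, z, -, hz, rfl⟩
      rw [map_add, hN.d_sq, zero_add] at hdx
      exact ⟨z, hdx, hz, y, (add_sub_cancel_right _ _).symm⟩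
    · rintro ⟨z, -, hz, w, hw⟩
      obtain ⟨y, hy, hdy⟩ := hN.exists_primitive_lt hv htf (Real.exp_pos b) w
        (hw ▸ hN.sub_lt hv hx (hz.trans (Real.exp_lt_exp.2 hab)))
      exact ⟨y, z, hy, hz, by rw [hdy, hw, sub_add_cancel]⟩
end

section
/- Uniform equivalence of the Gromov metric with the product metric (Lemma B.1). Let H be a real inner product space. For τ > 0, p ≥ 0 and X ∈ H define Q : ℝ × ℝ × H → ℝ by Q(a, b, w) = (τ² + p)·(a² + b²) + ‖X‖²·b² − 2·b·⟨X, w⟩ + ‖w‖², and the product form Q₀(a, b, w) = τ²·(a² + b²) + ‖w‖². Then for every ε > 0 there exists δ > 0 such that: for all τ > 0, all p with 0 ≤ p ≤ δ·τ², all X ∈ H with ‖X‖² ≤ δ·τ², and all (a, b, w) ∈ ℝ × ℝ × H, one has (1 + ε)⁻¹ · Q₀(a, b, w) ≤ Q(a, b, w) ≤ (1 + ε) · Q₀(a, b, w). In other words, the equivalence constant between Q and Q₀ tends to 1 as p/τ² and ‖X‖²/τ² tend to 0. -/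
/-!
Uniform equivalence of the Gromov metric with the product metric (Lemma B.1 of
"The local Floer cohomology of indicator functions"), in linear-algebraic form.

For a real inner product space `H`, `τ > 0`, `p ≥ 0`, `X ∈ H`, set
`Q (a, b, w) = (τ² + p)(a² + b²) + ‖X‖² b² − 2 b ⟪X, w⟫ + ‖w‖²` and
`Q₀ (a, b, w) = τ²(a² + b²) + ‖w‖²`.  For every `ε > 0` there is `δ > 0` such that
whenever `0 ≤ p ≤ δ τ²` and `‖X‖² ≤ δ τ²`,
`(1 + ε)⁻¹ Q₀ ≤ Q ≤ (1 + ε) Q₀` everywhere: the equivalence constant tends to `1`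
as `p/τ²` and `‖X‖²/τ²` tend to `0`.
-/

open scoped RealInnerProductSpace

/-- A scaled Young inequality for the cross term of the Gromov metric. -/
lemma abs_two_mul_inner_le {H : Type*} [NormedAddCommGroup H] [InnerProductSpace ℝ H]
    {s τ : ℝ} (hs : 0 < s) {X : H} (hX : ‖X‖ ^ 2 ≤ s ^ 2 * τ ^ 2) (b : ℝ) (w : H) :
    |2 * b * ⟪X, w⟫| ≤ s * (τ ^ 2 * b ^ 2 + ‖w‖ ^ 2) := by
  have hsub : 0 ≤ ‖b • X - s • w‖ ^ 2 := sq_nonneg _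
  have hadd : 0 ≤ ‖b • X + s • w‖ ^ 2 := sq_nonneg _
  rw [norm_sub_sq_real] at hsub
  rw [norm_add_sq_real] at hadd
  simp only [norm_smul, mul_pow, Real.norm_eq_abs, sq_abs, real_inner_smul_left,
    real_inner_smul_right] at hsub hadd
  have hbX := mul_le_mul_of_nonneg_left hX (sq_nonneg b)
  rw [abs_le]
  constructor <;> refine le_of_mul_le_mul_left ?_ hs <;> linarith

theorem gromov_metric_uniformly_equivalent_product
    {H : Type*} [NormedAddCommGroup H] [InnerProductSpace ℝ H] :
    ∀ ε : ℝ, 0 < ε → ∃ δ : ℝ, 0 < δ ∧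
      ∀ τ : ℝ, 0 < τ → ∀ p : ℝ, 0 ≤ p → p ≤ δ * τ ^ 2 →
        ∀ X : H, ‖X‖ ^ 2 ≤ δ * τ ^ 2 →
          ∀ (a b : ℝ) (w : H),
            (1 + ε)⁻¹ * (τ ^ 2 * (a ^ 2 + b ^ 2) + ‖w‖ ^ 2) ≤
                (τ ^ 2 + p) * (a ^ 2 + b ^ 2) + ‖X‖ ^ 2 * b ^ 2
                  - 2 * b * ⟪X, w⟫ + ‖w‖ ^ 2
              ∧
            (τ ^ 2 + p) * (a ^ 2 + b ^ 2) + ‖X‖ ^ 2 * b ^ 2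
                  - 2 * b * ⟪X, w⟫ + ‖w‖ ^ 2 ≤
                (1 + ε) * (τ ^ 2 * (a ^ 2 + b ^ 2) + ‖w‖ ^ 2) := by
  intro ε hε
  obtain ⟨s, hs, hs1, hsε, hsl⟩ :
      ∃ s : ℝ, 0 < s ∧ s ≤ 1 ∧ 3 * s ≤ ε ∧ 1 ≤ (1 + ε) * (1 - s) := by
    have h : ε / (3 * (1 + ε)) * (3 * (1 + ε)) = ε := by field_simp
    have hpos : 0 < ε / (3 * (1 + ε)) := by positivity
    refine ⟨ε / (3 * (1 + ε)), hpos, ?_, ?_, ?_⟩ <;> nlinarith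
  refine ⟨s ^ 2, by positivity, ?_⟩
  intro τ _ p hp hpδ X hX a b w
  obtain ⟨hlow, hup⟩ := abs_le.mp (abs_two_mul_inner_le hs hX b w)
  have hs2 : s ^ 2 ≤ s := by nlinarith
  have hab : 0 ≤ a ^ 2 + b ^ 2 := by positivity
  have hpab : p * (a ^ 2 + b ^ 2) ≤ s * τ ^ 2 * (a ^ 2 + b ^ 2) :=
    mul_le_mul_of_nonneg_right (hpδ.trans (by gcongr)) hab
  have hXb : ‖X‖ ^ 2 * b ^ 2 ≤ s * τ ^ 2 * b ^ 2 :=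
    mul_le_mul_of_nonneg_right (hX.trans (by gcongr)) (sq_nonneg b)
  have hpab0 : 0 ≤ p * (a ^ 2 + b ^ 2) := by positivity
  have hXb0 : 0 ≤ ‖X‖ ^ 2 * b ^ 2 := by positivity
  have hsa : 0 ≤ s * (τ ^ 2 * a ^ 2) := by positivity
  have hsw : 0 ≤ s * ‖w‖ ^ 2 := by positivity
  have hQ₀ : 0 ≤ τ ^ 2 * (a ^ 2 + b ^ 2) + ‖w‖ ^ 2 := by positivity
  constructor
  · have hinv : (1 + ε)⁻¹ ≤ 1 - s := (inv_le_iff_one_le_mul₀' (by positivity)).mpr hsl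
    have := mul_le_mul_of_nonneg_right hinv hQ₀
    linarith
  · have := mul_le_mul_of_nonneg_right hsε hQ₀
    linarith
end
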